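/- For every policy μ, the expected cost accumulated from state 0 until the first return to state 0, namely C_μ = Σ_{k=1}^∞ Σ over all tuples (x_1, …, x_{k−1}) of nonzero natural numbers of [P_μ 0 x_1 · (∏_{m=1}^{k−2} P_μ x_m x_{m+1}) · P_μ x_{k−1} 0] · (Σ_{m=0}^{k−1} g(x_m, μ x_m)) with x_0 = 0 (a sum valued in [0,∞]), satisfies C_μ ≤ φmax·N_μ, where φmax = k0m·θ/(Σ_r (kl r)·τmin) + Σ_r (km r)·τmax; in particular, if N_μ < ∞ then C_μ < ∞. -/

import Mathlib

open Finset in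
lemma path_sum_le (P : ℕ → ℕ → ENNReal) (hP : ∀ a, ∑' b, P a b ≤ 1) (k : ℕ) :
    ∀ a : ℕ, ∑' w : Fin k → ℕ,
      ∏ m : Fin k, P ((Fin.cons a w : Fin (k + 1) → ℕ) m.castSucc)
        ((Fin.cons a w : Fin (k + 1) → ℕ) m.succ) ≤ 1 := by
  induction k with
  | zero => intro a; simp
  | succ k ih =>
    intro a
    rw [← (Fin.consEquiv (fun _ : Fin (k + 1) => ℕ)).tsum_eq, ENNReal.tsum_prod']
    calc _ = ∑' b : ℕ, P a b * ∑' w : Fin k → ℕ,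
          ∏ m : Fin k, P ((Fin.cons b w : Fin (k + 1) → ℕ) m.castSucc)
          ((Fin.cons b w : Fin (k + 1) → ℕ) m.succ) := by
          refine tsum_congr fun b => ?_
          rw [← ENNReal.tsum_mul_left]
          refine tsum_congr fun w => ?_
          rw [Fin.prod_univ_succ]
          simp [Fin.consEquiv, ← Fin.succ_castSucc]
      _ ≤ ∑' b : ℕ, P a b * 1 := ENNReal.tsum_le_tsum fun b => by gcongr; exact ih b
      _ ≤ 1 := by simpa using hP a

lemma poisson_hasSum (l : ℝ) :
    HasSum (fun y : ℕ => Real.exp (-l) * l ^ y / (Nat.factorial y : ℝ)) 1 := by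
  have h := (NormedSpace.expSeries_div_hasSum_exp l).mul_left (Real.exp (-l))
  rw [← Real.exp_eq_exp_ℝ, ← Real.exp_add] at h
  simpa [mul_div_assoc] using h

lemma poisson_mean_hasSum (l : ℝ) :
    HasSum (fun y : ℕ => Real.exp (-l) * l ^ y / (Nat.factorial y : ℝ) * y) l := by
  rw [← hasSum_nat_add_iff' 1]
  have h := (poisson_hasSum l).mul_left l
  simp only [mul_one] at h
  convert h using 1
  · rfl
  · funext y
    rw [Nat.factorial_succ]
    have : (Nat.factorial y : ℝ) ≠ 0 := by positivity
    push_cast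
    field_simp
    ring
  · simp

theorem stmt8
    (R : ℕ) (hR : 1 ≤ R)
    (θ τmin τmax : ℝ) (hθ : 0 < θ) (hτmin : 0 < τmin) (hττ : τmin ≤ τmax)
    (TSTT : ℕ → (Fin R → ℝ) → ℝ)
    (k0l k0m : ℝ) (kl km : Fin R → ℝ)
    (hk0l : 0 < k0l) (hk0 : k0l ≤ k0m)
    (hklpos : ∀ r, 0 < kl r) (hklm : ∀ r, kl r ≤ km r)
    (hTSTT_lb : ∀ (x : ℕ) (u : Fin R → ℝ), (∀ r, τmin ≤ u r ∧ u r ≤ τmax) →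
      k0l * x + ∑ r, kl r * u r ≤ TSTT x u)
    (hTSTT_ub : ∀ (x : ℕ) (u : Fin R → ℝ), (∀ r, τmin ≤ u r ∧ u r ≤ τmax) →
      TSTT x u ≤ k0m * x + ∑ r, km r * u r)
    (p : ℕ → ℕ → (Fin R → ℝ) → ℝ)
    (hp : ∀ (x y : ℕ) (u : Fin R → ℝ), p x y u =
      Real.exp (-(θ / TSTT x u)) * (θ / TSTT x u) ^ y / (Nat.factorial y : ℝ))
    (g : ℕ → (Fin R → ℝ) → ℝ)
    (hg : ∀ (x : ℕ) (u : Fin R → ℝ), g x u = ∑' y : ℕ, p x y u * TSTT y u)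
    (μ : ℕ → Fin R → ℝ) (hμ : ∀ (i : ℕ) (r : Fin R), τmin ≤ μ i r ∧ μ i r ≤ τmax)
    (f : ℕ → ℝ)
    (hf : ∀ k : ℕ, 1 ≤ k → f k =
      ∑' w : {w : Fin (k + 1) → ℕ // w 0 = 0 ∧ w (Fin.last k) = 0 ∧
          ∀ m : Fin (k + 1), m ≠ 0 → m ≠ Fin.last k → w m ≠ 0},
        ∏ m : Fin k, p (w.1 m.castSucc) (w.1 m.succ) (μ (w.1 m.castSucc)))
    (N C : ENNReal)
    (hN : N = ∑' k : ℕ, ENNReal.ofReal ((k : ℝ) * f k))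
    (hC : C = ∑' k : ℕ,
      ∑' w : {w : Fin (k + 1 + 1) → ℕ // w 0 = 0 ∧ w (Fin.last (k + 1)) = 0 ∧
          ∀ m : Fin (k + 1 + 1), m ≠ 0 → m ≠ Fin.last (k + 1) → w m ≠ 0},
        ENNReal.ofReal
          ((∏ m : Fin (k + 1), p (w.1 m.castSucc) (w.1 m.succ) (μ (w.1 m.castSucc))) *
            (∑ m : Fin (k + 1), g (w.1 m.castSucc) (μ (w.1 m.castSucc))))) :
    C ≤ ENNReal.ofReal (k0m * θ / (∑ r, kl r * τmin) + ∑ r, km r * τmax) * N ∧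
      (N < ⊤ → C < ⊤) := by
  have hne : (Finset.univ : Finset (Fin R)).Nonempty := ⟨⟨0, hR⟩, Finset.mem_univ _⟩
  have hS : 0 < ∑ r, kl r * τmin := Finset.sum_pos (fun r _ => mul_pos (hklpos r) hτmin) hne
  have hk0m : 0 < k0m := hk0l.trans_le hk0
  have hkm : ∀ r, 0 < km r := fun r => (hklpos r).trans_le (hklm r)
  have hTlow : ∀ x u, (∀ r, τmin ≤ u r ∧ u r ≤ τmax) → ∑ r, kl r * τmin ≤ TSTT x u := by
    intro x u hu
    refine le_trans ?_ (hTSTT_lb x u hu)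
    have h1 : ∑ r, kl r * τmin ≤ ∑ r, kl r * u r :=
      Finset.sum_le_sum fun r _ => mul_le_mul_of_nonneg_left (hu r).1 (hklpos r).le
    have h2 : 0 ≤ k0l * (x : ℝ) := by positivity
    linarith
  have hTpos : ∀ x u, (∀ r, τmin ≤ u r ∧ u r ≤ τmax) → 0 < TSTT x u :=
    fun x u hu => hS.trans_le (hTlow x u hu)
  have hp0 : ∀ x y u, (∀ r, τmin ≤ u r ∧ u r ≤ τmax) → 0 ≤ p x y u := by
    intro x y u hu
    have := hTpos x u hu
    rw [hp]; positivity
  have hpsum : ∀ x u, HasSum (fun y => p x y u) 1 := by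
    intro x u
    simp only [hp]
    exact poisson_hasSum _
  have hpmean : ∀ x u, HasSum (fun y : ℕ => p x y u * y) (θ / TSTT x u) := by
    intro x u
    simp only [hp]
    exact poisson_mean_hasSum _
  set φ : ℝ := k0m * θ / (∑ r, kl r * τmin) + ∑ r, km r * τmax with hφ
  have hφ0 : 0 ≤ φ := by
    have : 0 ≤ ∑ r, km r * τmax :=
      Finset.sum_nonneg fun r _ => mul_nonneg (hkm r).le (hτmin.le.trans hττ)
    positivity
  have hgle : ∀ x u, (∀ r, τmin ≤ u r ∧ u r ≤ τmax) → g x u ≤ φ := by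
    intro x u hu
    have hmaj : HasSum (fun y : ℕ => k0m * (p x y u * y) + (∑ r, km r * τmax) * p x y u)
        (k0m * (θ / TSTT x u) + (∑ r, km r * τmax) * 1) :=
      ((hpmean x u).mul_left _).add ((hpsum x u).mul_left _)
    have hle : ∀ y : ℕ, p x y u * TSTT y u ≤
        k0m * (p x y u * y) + (∑ r, km r * τmax) * p x y u := by
      intro y
      have h1 := hTSTT_ub y u hu
      have h2 : ∑ r, km r * u r ≤ ∑ r, km r * τmax :=
        Finset.sum_le_sum fun r _ => mul_le_mul_of_nonneg_left (hu r).2 (hkm r).le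
      have h3 := mul_le_mul_of_nonneg_left (h1.trans (add_le_add_right h2 _)) (hp0 x y u hu)
      linarith
    have hsum : Summable (fun y => p x y u * TSTT y u) :=
      Summable.of_nonneg_of_le (fun y => mul_nonneg (hp0 x y u hu) (hTpos y u hu).le) hle
        hmaj.summable
    rw [hg]
    refine (hasSum_le hle hsum.hasSum hmaj).trans ?_
    rw [hφ, mul_one, mul_div_assoc]
    gcongr
    exact hTlow x u hu
  have key : C ≤ ENNReal.ofReal φ * N := by
    rw [hC, hN]
    refine le_trans ?_ (mul_le_mul_right (ENNReal.tsum_comp_le_tsum_of_injective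
      (add_left_injective 1) (fun k : ℕ => ENNReal.ofReal ((k : ℝ) * f k))) _)
    rw [← ENNReal.tsum_mul_left]
    refine ENNReal.tsum_le_tsum fun k => ?_
    set W := {w : Fin (k + 1 + 1) → ℕ // w 0 = 0 ∧ w (Fin.last (k + 1)) = 0 ∧
          ∀ m : Fin (k + 1 + 1), m ≠ 0 → m ≠ Fin.last (k + 1) → w m ≠ 0} with hW
    let q : W → ℝ := fun w =>
      ∏ m : Fin (k + 1), p (w.1 m.castSucc) (w.1 m.succ) (μ (w.1 m.castSucc))
    have hq0 : ∀ w, 0 ≤ q w := fun w => Finset.prod_nonneg fun m _ => hp0 _ _ _ (hμ _)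
    have hqsum : ∑' w : W, ENNReal.ofReal (q w) ≤ 1 := by
      let P : ℕ → ℕ → ENNReal := fun a b => ENNReal.ofReal (p a b (μ a))
      have hP : ∀ a, ∑' b, P a b ≤ 1 := by
        intro a
        rw [← ENNReal.ofReal_tsum_of_nonneg (fun b => hp0 _ _ _ (hμ a)) (hpsum a _).summable,
          (hpsum a _).tsum_eq]
        simp
      have hcons : ∀ w : W, (Fin.cons 0 (Fin.tail w.1) : Fin (k + 1 + 1) → ℕ) = w.1 := by
        intro w
        conv_rhs => rw [← Fin.cons_self_tail w.1]
        rw [w.2.1]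
      have hinj : Function.Injective (fun w : W => (Fin.tail w.1 : Fin (k + 1) → ℕ)) := by
        intro w v h
        apply Subtype.ext
        rw [← hcons w, ← hcons v]
        exact congrArg _ h
      refine le_trans ?_ (path_sum_le P hP (k + 1) 0)
      refine le_trans (le_of_eq ?_) (ENNReal.tsum_comp_le_tsum_of_injective hinj _)
      refine tsum_congr fun w => ?_
      simp only [Function.comp, hcons]
      exact ENNReal.ofReal_prod_of_nonneg fun m _ => hp0 _ _ _ (hμ _)
    have hqs : Summable q := by
      have h := ENNReal.summable_toReal (ne_top_of_le_ne_top ENNReal.one_ne_top hqsum)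
      simpa [ENNReal.toReal_ofReal, hq0] using h
    have hfk : f (k + 1) = ∑' w : W, q w := hf (k + 1) (by omega)
    rw [hfk, ← ENNReal.ofReal_mul hφ0, ← mul_assoc, ENNReal.ofReal_mul (by positivity),
      ENNReal.ofReal_tsum_of_nonneg hq0 hqs, ← ENNReal.tsum_mul_left]
    refine ENNReal.tsum_le_tsum fun w => ?_
    rw [← ENNReal.ofReal_mul (by positivity), mul_comm (φ * _)]
    apply ENNReal.ofReal_le_ofReal
    refine mul_le_mul_of_nonneg_left ?_ (hq0 w)
    refine (Finset.sum_le_sum fun m _ => hgle _ _ (hμ _)).trans (le_of_eq ?_)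
    simp [mul_comm]
  exact ⟨key, fun h => key.trans_lt (ENNReal.mul_lt_top ENNReal.ofReal_lt_top h)⟩
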